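/- Let 1/3 < K < 1, μ = (3K−1)/(1−K), t₀ ∈ (0,1], and let w : (0,t₀] → ℝ be differentiable with w(t) ≠ 0 for all t ∈ (0,t₀], satisfy the asymptotic ODE w'(t) = K μ t^{2μ−1} w(t) / (t^{2μ} + (1−K) w(t)²) on (0,t₀], and set w₀ = w(t₀). Then the limit lim_{t→0⁺} w(t) exists and equals sgn(w₀) · |w₀|^{1/(1−K)} / (t₀^{2μ} + w₀²)^{K/(2(1−K))}. -/

import Mathlib

/-- The limit of a nonvanishing solution of the asymptotic ODE as `t → 0⁺`. -/
theorem stmt6 (K μ t₀ : ℝ) (hK : 1/3 < K) (hK' : K < 1)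
    (hμ : μ = (3*K - 1)/(1 - K))
    (ht₀ : t₀ ∈ Set.Ioc (0:ℝ) 1)
    (w : ℝ → ℝ)
    (hw0 : ∀ t ∈ Set.Ioc (0:ℝ) t₀, w t ≠ 0)
    (hode : ∀ t ∈ Set.Ioc (0:ℝ) t₀,
      HasDerivAt w
        (K * μ * t ^ (2*μ - 1) * w t / (t ^ (2*μ) + (1 - K) * (w t)^2)) t)
    (w₀ : ℝ) (hw₀ : w₀ = w t₀) :
    Filter.Tendsto w (nhdsWithin 0 (Set.Ioi 0))
      (nhds (Real.sign w₀ * |w₀| ^ ((1:ℝ)/(1 - K)) /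
        (t₀ ^ (2*μ) + w₀^2) ^ (K/(2*(1 - K))))) := by
  have h1K : 0 < 1 - K := by linarith
  have hμ0 : 0 < μ := by rw [hμ]; exact div_pos (by linarith) h1K
  have htp : 0 < t₀ := ht₀.1
  subst hw₀
  set L : ℝ → ℝ := fun t => Real.log (w t) - K/2 * Real.log (t ^ (2*μ) + (w t)^2) with hL
  have hspos : ∀ t ∈ Set.Ioc (0:ℝ) t₀, 0 < t ^ (2*μ) := fun t ht => Real.rpow_pos_of_pos ht.1 _
  have hw2 : ∀ t ∈ Set.Ioc (0:ℝ) t₀, 0 < (w t)^2 := fun t ht => by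
    have := hw0 t ht
    positivity
  have hLd : ∀ t ∈ Set.Ioc (0:ℝ) t₀, HasDerivAt L 0 t := by
    intro t ht
    have hs := hspos t ht
    have hw := hw2 t ht
    have h1 := (hode t ht).log (hw0 t ht)
    have h2 : HasDerivAt (fun t : ℝ => t ^ (2*μ)) (2*μ * t ^ (2*μ-1)) t :=
      Real.hasDerivAt_rpow_const (Or.inl ht.1.ne')
    have h3 := ((h2.add ((hode t ht).pow 2)).log (by simpa using (add_pos hs hw).ne')).const_mul (K/2)
    have h4 := h1.sub h3
    refine h4.congr_deriv ?_
    have hn := hw0 t ht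
    have hd1 : t ^ (2*μ) + (1-K) * (w t)^2 ≠ 0 := by positivity
    have hd2 : t ^ (2*μ) + (w t)^2 ≠ 0 := by positivity
    simp only [Pi.add_apply, Pi.pow_apply]
    generalize t ^ (2*μ-1) = r at *
    generalize t ^ (2*μ) = s at *
    field_simp
    push_cast
    ring
  have hLc : ∀ t ∈ Set.Ioc (0:ℝ) t₀, L t = L t₀ := by
    intro t ht
    have hsub : ∀ x ∈ Set.Icc t t₀, x ∈ Set.Ioc (0:ℝ) t₀ := fun x hx => ⟨ht.1.trans_le hx.1, hx.2⟩
    exact (constant_of_has_deriv_right_zero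
      (fun x hx => (hLd x (hsub x hx)).continuousAt.continuousWithinAt)
      (fun x hx => (hLd x (hsub x ⟨hx.1, hx.2.le⟩)).hasDerivWithinAt) t₀ ⟨ht.2, le_rfl⟩).symm
  have hkey : ∀ t ∈ Set.Ioc (0:ℝ) t₀, Real.log (w t) =
      L t₀/(1-K) + K/(2*(1-K)) * Real.log (1 + t^(2*μ)/(w t)^2) := by
    intro t ht
    have hs := hspos t ht
    have hw := hw2 t ht
    have e : 1 + t^(2*μ)/(w t)^2 = (t^(2*μ) + (w t)^2)/(w t)^2 := by rw [add_div, div_self hw.ne', add_comm]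
    rw [e, Real.log_div (by positivity) hw.ne', Real.log_pow, ← hLc t ht]
    simp only [hL]
    field_simp
    push_cast
    ring
  have hlow : ∀ t ∈ Set.Ioc (0:ℝ) t₀, Real.exp (L t₀/(1-K)) ≤ |w t| := by
    intro t ht
    have hs := hspos t ht
    have hw := hw2 t ht
    rw [← Real.exp_log (abs_pos.2 (hw0 t ht)), Real.log_abs, Real.exp_le_exp, hkey t ht]
    have : 0 ≤ Real.log (1 + t^(2*μ)/(w t)^2) := Real.log_nonneg (by
      have : 0 < t^(2*μ)/(w t)^2 := by positivity
      linarith)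
    have hK0 : 0 < K := by linarith
    have : 0 ≤ K/(2*(1-K)) * Real.log (1 + t^(2*μ)/(w t)^2) := by positivity
    linarith
  have hev : ∀ᶠ t in nhdsWithin (0:ℝ) (Set.Ioi 0), t ∈ Set.Ioc (0:ℝ) t₀ :=
    Ioc_mem_nhdsGT htp
  set C := Real.exp (L t₀/(1-K)) with hC
  have hCp : 0 < C := Real.exp_pos _
  have hst : Filter.Tendsto (fun t : ℝ => t^(2*μ)) (nhdsWithin 0 (Set.Ioi 0)) (nhds 0) := by
    have : ContinuousAt (fun t : ℝ => t^(2*μ)) 0 :=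
      Real.continuousAt_rpow_const _ _ (Or.inr (by positivity))
    have h := this.tendsto
    simp only [Real.zero_rpow (by positivity : 2*μ ≠ 0)] at h
    exact h.mono_left nhdsWithin_le_nhds
  have hq : Filter.Tendsto (fun t : ℝ => t^(2*μ)/(w t)^2) (nhdsWithin 0 (Set.Ioi 0)) (nhds 0) := by
    have h2 : Filter.Tendsto (fun t : ℝ => t^(2*μ)/C^2) (nhdsWithin 0 (Set.Ioi 0)) (nhds 0) := by
      simpa using hst.div_const (C^2)
    refine squeeze_zero' ?_ ?_ h2
    · filter_upwards [hev] with t ht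
      exact (div_pos (hspos t ht) (hw2 t ht)).le
    · filter_upwards [hev] with t ht
      refine div_le_div_of_nonneg_left (hspos t ht).le (by positivity) ?_
      rw [← sq_abs (w t)]
      exact pow_le_pow_left₀ hCp.le (hlow t ht) 2
  have hlog : Filter.Tendsto (fun t => Real.log (w t)) (nhdsWithin 0 (Set.Ioi 0))
      (nhds (L t₀/(1-K))) := by
    have h1 : Filter.Tendsto (fun t : ℝ => 1 + t^(2*μ)/(w t)^2) (nhdsWithin 0 (Set.Ioi 0))
        (nhds 1) := by simpa using hq.const_add 1
    have h2 := ((h1.log one_ne_zero).const_mul (K/(2*(1-K)))).const_add (L t₀/(1-K))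
    simp only [Real.log_one, mul_zero, add_zero] at h2
    refine h2.congr' ?_
    filter_upwards [hev] with t ht
    exact (hkey t ht).symm
  have hsign : ∀ t ∈ Set.Ioc (0:ℝ) t₀, Real.sign (w t) = Real.sign (w t₀) := by
    have hc : ContinuousOn w (Set.Ioc 0 t₀) :=
      fun x hx => (hode x hx).continuousAt.continuousWithinAt
    have hpc : IsPreconnected (w '' Set.Ioc 0 t₀) := isPreconnected_Ioc.image w hc
    have hno : (0:ℝ) ∉ w '' Set.Ioc 0 t₀ := by
      rintro ⟨x, hx, h⟩
      exact hw0 x hx h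
    have ht0m : t₀ ∈ Set.Ioc (0:ℝ) t₀ := ⟨htp, le_rfl⟩
    intro t ht
    have m1 := Set.mem_image_of_mem w ht
    have m2 := Set.mem_image_of_mem w ht0m
    rcases lt_or_gt_of_ne (hw0 t ht) with h | h <;>
      rcases lt_or_gt_of_ne (hw0 t₀ ht0m) with h' | h'
    · rw [Real.sign_of_neg h, Real.sign_of_neg h']
    · exact (hno (hpc.Icc_subset m1 m2 ⟨h.le, h'.le⟩)).elim
    · exact (hno (hpc.Icc_subset m2 m1 ⟨h'.le, h.le⟩)).elim
    · rw [Real.sign_of_pos h, Real.sign_of_pos h']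
  have ht0m : t₀ ∈ Set.Ioc (0:ℝ) t₀ := ⟨htp, le_rfl⟩
  have hCeq : Real.sign (w t₀) * |w t₀| ^ ((1:ℝ)/(1 - K)) /
        (t₀ ^ (2*μ) + (w t₀)^2) ^ (K/(2*(1 - K))) = Real.sign (w t₀) * C := by
    have hp := add_pos (hspos t₀ ht0m) (hw2 t₀ ht0m)
    rw [mul_div_assoc, Real.rpow_def_of_pos (abs_pos.2 (hw0 t₀ ht0m)),
      Real.rpow_def_of_pos hp, ← Real.exp_sub, Real.log_abs, hC]
    congr 2
    simp only [hL]
    field_simp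
  rw [hCeq]
  refine ((Real.continuous_exp.continuousAt.tendsto.comp hlog).const_mul
    (Real.sign (w t₀))).congr' ?_
  filter_upwards [hev] with t ht
  simp only [Function.comp]
  rw [← hsign t ht, Real.exp_log_eq_abs (hw0 t ht)]
  rcases lt_or_gt_of_ne (hw0 t ht) with h | h
  · rw [Real.sign_of_neg h, abs_of_neg h]; ring
  · rw [Real.sign_of_pos h, abs_of_pos h]; ring
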